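/- arXiv:2601.10713 — 2 statements merged into one kernel-verified Lean document; each statement's English description precedes it below -/
import Mathlib

section
/- For every w, every w-element subset of {1,…,n} that is the support of some NTLO is a stopping set of the CSS code; consequently A^NTLO(w) ≤ A^SS(w) for all w. -/
/-- Support of a vector over 𝔽₂, as a finset of coordinates. -/
def supp {n : ℕ} (v : Fin n → ZMod 2) : Finset (Fin n) :=
  Finset.univ.filter (fun j => v j ≠ 0)

/-- `S` is a stopping set of `H`: `S` is nonempty and every check with at least one
neighbor in `S` has at least two neighbors in `S`. -/
def IsStoppingSet {m n : ℕ} (H : Matrix (Fin m) (Fin n) (ZMod 2)) (S : Finset (Fin n)) : Prop :=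
  S.Nonempty ∧ ∀ i : Fin m,
    1 ≤ (S.filter (fun j => H i j = 1)).card → 2 ≤ (S.filter (fun j => H i j = 1)).card

/-- Check `i` is dangling for the erasure set `E`: exactly one `j ∈ E` has `H i j = 1`. -/
def Dangling {m n : ℕ} (H : Matrix (Fin m) (Fin n) (ZMod 2)) (E : Finset (Fin n))
    (i : Fin m) : Prop :=
  (E.filter (fun j => H i j = 1)).card = 1

/-- A peel step: some check `i` is dangling for `E` with unique erased neighbor `j`,
which is removed from `E`. -/
def PeelStep {m n : ℕ} (H : Matrix (Fin m) (Fin n) (ZMod 2)) (E E' : Finset (Fin n)) : Prop :=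
  ∃ i : Fin m, ∃ j ∈ E, E.filter (fun j' => H i j' = 1) = {j} ∧ E' = E.erase j

/-- A guess step: permitted only when no check is dangling for `E`; removes an
arbitrary single element of `E`. -/
def GuessStep {m n : ℕ} (H : Matrix (Fin m) (Fin n) (ZMod 2)) (E E' : Finset (Fin n)) : Prop :=
  (∀ i : Fin m, ¬ Dangling H E i) ∧ ∃ j ∈ E, E' = E.erase j

/-- A Maxwell step is a peel step or a guess step. -/
def MaxwellStep {m n : ℕ} (H : Matrix (Fin m) (Fin n) (ZMod 2)) (E E' : Finset (Fin n)) : Prop :=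
  PeelStep H E E' ∨ GuessStep H E E'

/-- A Maxwell trace from `E`: a finite sequence of peel/guess steps transforming `E`
into the empty set. -/
def IsMaxwellTrace {m n : ℕ} (H : Matrix (Fin m) (Fin n) (ZMod 2)) (E : Finset (Fin n))
    (k : ℕ) (f : Fin (k+1) → Finset (Fin n)) : Prop :=
  f 0 = E ∧ f (Fin.last k) = ∅ ∧ ∀ i : Fin k, MaxwellStep H (f i.castSucc) (f i.succ)

/-- Number of guess steps in a trace: the steps starting from a state with no
dangling check (these are exactly the guess steps). -/
noncomputable def guessCount {m n : ℕ} (H : Matrix (Fin m) (Fin n) (ZMod 2)) {k : ℕ}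
    (f : Fin (k+1) → Finset (Fin n)) : ℕ :=
  Nat.card {i : Fin k // ∀ c : Fin m, ¬ Dangling H (f i.castSucc) c}

/-- Row space of `H`: the 𝔽₂-span of the rows of `H` in 𝔽₂ⁿ. -/
def rowSpace {m n : ℕ} (H : Matrix (Fin m) (Fin n) (ZMod 2)) :
    Submodule (ZMod 2) (Fin n → ZMod 2) :=
  Submodule.span (ZMod 2) (Set.range fun i => H i)

/-- Nontrivial logical operator of the CSS code `(HX, HZ)`. -/
def IsNTLO {mX mZ n : ℕ} (HX : Matrix (Fin mX) (Fin n) (ZMod 2))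
    (HZ : Matrix (Fin mZ) (Fin n) (ZMod 2)) (v : Fin n → ZMod 2) : Prop :=
  v ≠ 0 ∧ ((HZ.mulVec v = 0 ∧ v ∉ rowSpace HX) ∨ (HX.mulVec v = 0 ∧ v ∉ rowSpace HZ))

/-- A stopping set of the CSS code: a stopping set of `HX` or of `HZ`. -/
def IsCSSStoppingSet {mX mZ n : ℕ} (HX : Matrix (Fin mX) (Fin n) (ZMod 2))
    (HZ : Matrix (Fin mZ) (Fin n) (ZMod 2)) (S : Finset (Fin n)) : Prop :=
  IsStoppingSet HX S ∨ IsStoppingSet HZ S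

/-- `ASS w`: number of `w`-element subsets of coordinates that are stopping sets
of the CSS code. -/
noncomputable def ASS {mX mZ n : ℕ} (HX : Matrix (Fin mX) (Fin n) (ZMod 2))
    (HZ : Matrix (Fin mZ) (Fin n) (ZMod 2)) (w : ℕ) : ℕ :=
  Nat.card {S : Finset (Fin n) // S.card = w ∧ IsCSSStoppingSet HX HZ S}

/-- `ANTLO w`: number of `w`-element subsets of coordinates that are the support of
some nontrivial logical operator. -/
noncomputable def ANTLO {mX mZ n : ℕ} (HX : Matrix (Fin mX) (Fin n) (ZMod 2))
    (HZ : Matrix (Fin mZ) (Fin n) (ZMod 2)) (w : ℕ) : ℕ :=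
  Nat.card {S : Finset (Fin n) // S.card = w ∧ ∃ v, IsNTLO HX HZ v ∧ supp v = S}

/-- `W0 t = {w : 0 < w ≤ t and ASS w > ANTLO w}`. -/
noncomputable def W0 {mX mZ n : ℕ} (HX : Matrix (Fin mX) (Fin n) (ZMod 2))
    (HZ : Matrix (Fin mZ) (Fin n) (ZMod 2)) (t : ℕ) : Finset ℕ :=
  (Finset.range (t+1)).filter (fun w => 0 < w ∧ ANTLO HX HZ w < ASS HX HZ w)

/-- The distribution gap `γ(t) = |W0(t)|`. -/
noncomputable def gam {mX mZ n : ℕ} (HX : Matrix (Fin mX) (Fin n) (ZMod 2))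
    (HZ : Matrix (Fin mZ) (Fin n) (ZMod 2)) (t : ℕ) : ℕ :=
  (W0 HX HZ t).card

/-- `F_ML`: erasure sets containing the support of some NTLO. -/
def FML {mX mZ n : ℕ} (HX : Matrix (Fin mX) (Fin n) (ZMod 2))
    (HZ : Matrix (Fin mZ) (Fin n) (ZMod 2)) : Set (Finset (Fin n)) :=
  {E | ∃ v, IsNTLO HX HZ v ∧ supp v ⊆ E}

/-- `F_QM(G)`: erasure sets admitting some Maxwell trace (with respect to `HZ` or to
`HX`) with more than `G` guess steps. -/
def FQM {mX mZ n : ℕ} (HX : Matrix (Fin mX) (Fin n) (ZMod 2))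
    (HZ : Matrix (Fin mZ) (Fin n) (ZMod 2)) (G : ℕ) : Set (Finset (Fin n)) :=
  {E | (∃ (k : ℕ) (f : Fin (k+1) → Finset (Fin n)),
          IsMaxwellTrace HZ E k f ∧ G < guessCount HZ f) ∨
       (∃ (k : ℕ) (f : Fin (k+1) → Finset (Fin n)),
          IsMaxwellTrace HX E k f ∧ G < guessCount HX f)}

open Classical in
/-- `P_F(ε) = Σ_{E ∈ F} ε^{|E|} (1-ε)^{n-|E|}`. -/
noncomputable def Pfail (n : ℕ) (F : Set (Finset (Fin n))) (ε : ℝ) : ℝ :=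
  ∑ E ∈ Finset.univ.filter (fun E : Finset (Fin n) => E ∈ F),
    ε ^ E.card * (1 - ε) ^ (n - E.card)

lemma two_le_card_filter_of_mulVec_eq_zero {m n : ℕ} {H : Matrix (Fin m) (Fin n) (ZMod 2)}
    {v : Fin n → ZMod 2} (hv : H.mulVec v = 0) (i : Fin m)
    (hi : 1 ≤ ((supp v).filter (fun j => H i j = 1)).card) :
    2 ≤ ((supp v).filter (fun j => H i j = 1)).card := by
  by_contra hlt
  obtain ⟨j, hj⟩ := Finset.card_eq_one.mp (le_antisymm (by omega) hi)
  have mem_iff : ∀ k, v k ≠ 0 ∧ H i k = 1 ↔ k = j := fun k => by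
    simpa [supp] using Finset.ext_iff.mp hj k
  have hsum : ∑ k, H i k * v k = 0 := congrFun hv i
  rw [Finset.sum_eq_single j] at hsum
  · obtain ⟨hvj, hHj⟩ := (mem_iff j).mpr rfl
    simp [hHj, hvj] at hsum
  · intro k _ hk
    by_cases hvk : v k = 0
    · simp [hvk]
    · have hHk : H i k ≠ 1 := fun h => hk ((mem_iff k).mp ⟨hvk, h⟩)
      have hzero : ∀ a : ZMod 2, a ≠ 1 → a = 0 := by decide
      simp [hzero _ hHk]
  · simp

/-- The support of a nonzero codeword of `ker H` is a stopping set of `H`. -/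
lemma isStoppingSet_supp {m n : ℕ} {H : Matrix (Fin m) (Fin n) (ZMod 2)}
    {v : Fin n → ZMod 2} (hv : H.mulVec v = 0) (hne : v ≠ 0) : IsStoppingSet H (supp v) := by
  obtain ⟨j, hj⟩ := Function.ne_iff.mp hne
  exact ⟨⟨j, by simpa [supp] using hj⟩, two_le_card_filter_of_mulVec_eq_zero hv⟩

lemma IsNTLO.isCSSStoppingSet_supp {mX mZ n : ℕ} {HX : Matrix (Fin mX) (Fin n) (ZMod 2)}
    {HZ : Matrix (Fin mZ) (Fin n) (ZMod 2)} {v : Fin n → ZMod 2} (h : IsNTLO HX HZ v) :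
    IsCSSStoppingSet HX HZ (supp v) := by
  obtain ⟨hne, ⟨hv, _⟩ | ⟨hv, _⟩⟩ := h
  · exact Or.inr (isStoppingSet_supp hv hne)
  · exact Or.inl (isStoppingSet_supp hv hne)

/-- Every `w`-element subset that is the support of some NTLO is a
stopping set of the CSS code; consequently `ANTLO w ≤ ASS w` for all `w`. -/
theorem ntlo_support_is_stopping_set_and_count_le {mX mZ n : ℕ}
    (HX : Matrix (Fin mX) (Fin n) (ZMod 2)) (HZ : Matrix (Fin mZ) (Fin n) (ZMod 2))
    (hCSS : HX * HZ.transpose = 0) :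
    (∀ (w : ℕ) (S : Finset (Fin n)), S.card = w →
      (∃ v, IsNTLO HX HZ v ∧ supp v = S) → IsCSSStoppingSet HX HZ S) ∧
    (∀ w : ℕ, ANTLO HX HZ w ≤ ASS HX HZ w) := by
  refine ⟨?_, fun w => ?_⟩
  · rintro w S - ⟨v, hv, rfl⟩
    exact hv.isCSSStoppingSet_supp
  · refine Nat.card_mono (Set.toFinite _) ?_
    rintro S ⟨hcard, v, hv, rfl⟩
    exact ⟨hcard, hv.isCSSStoppingSet_supp⟩
end

section
/- Assume the CSS code admits at least one NTLO and at least one stopping set, let d be the minimum Hamming weight of an NTLO, s the minimum size of a stopping set of the CSS code, and suppose G ≥ d − s + 1. Then p_L^QM(G)(ε) / p_L^ML(ε) → 1 as ε → 0⁺. -/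
theorem MaxwellStep.card_add_one {m n : ℕ} {H : Matrix (Fin m) (Fin n) (ZMod 2)}
    {E E' : Finset (Fin n)} (h : MaxwellStep H E E') : E'.card + 1 = E.card := by
  rcases h with ⟨i, j, hj, -, rfl⟩ | ⟨-, j, hj, rfl⟩ <;> exact Finset.card_erase_add_one hj

theorem isStoppingSet_of_not_dangling {m n : ℕ} {H : Matrix (Fin m) (Fin n) (ZMod 2)}
    {E : Finset (Fin n)} (hE : E.Nonempty) (h : ∀ i, ¬ Dangling H E i) : IsStoppingSet H E := by
  refine ⟨hE, fun i hi => ?_⟩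
  have := h i
  unfold Dangling at this
  omega

theorem IsMaxwellTrace.card_add {m n : ℕ} {H : Matrix (Fin m) (Fin n) (ZMod 2)}
    {E : Finset (Fin n)} {k : ℕ} {f : Fin (k + 1) → Finset (Fin n)}
    (h : IsMaxwellTrace H E k f) (i : Fin (k + 1)) : (f i).card + i = E.card := by
  induction i using Fin.induction with
  | zero => simp [h.1]
  | succ i ih =>
    have := (h.2.2 i).card_add_one
    simp only [Fin.val_succ, Fin.val_castSucc] at ih ⊢
    omega

/-- Every guess is made from a stopping set, and every step removes one element, so the number of
guesses in a trace from `E` is at most `|E| + 1 - s`. -/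
theorem IsMaxwellTrace.guessCount_le {m n s : ℕ} {H : Matrix (Fin m) (Fin n) (ZMod 2)}
    {E : Finset (Fin n)} {k : ℕ} {f : Fin (k + 1) → Finset (Fin n)}
    (h : IsMaxwellTrace H E k f) (hs : ∀ S, IsStoppingSet H S → s ≤ S.card) :
    guessCount H f ≤ E.card + 1 - s := by
  have key : ∀ i : {i : Fin k // ∀ c : Fin m, ¬ Dangling H (f i.castSucc) c},
      (i : Fin k).val < E.card + 1 - s := by
    rintro ⟨i, hi⟩
    have hstep := (h.2.2 i).card_add_one
    have hcard := h.card_add i.castSucc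
    have hne : (f i.castSucc).Nonempty := Finset.card_pos.mp (by omega)
    have := hs _ (isStoppingSet_of_not_dangling hne hi)
    simp only [Fin.val_castSucc] at hcard ⊢
    omega
  rw [guessCount, ← Nat.card_fin (E.card + 1 - s)]
  refine Nat.card_le_card_of_injective (fun i => (⟨_, key i⟩ : Fin (E.card + 1 - s))) ?_
  intro a b hab
  exact Subtype.ext (Fin.ext (Fin.mk.inj hab))

theorem card_ge_of_mem_FQM {mX mZ n s G : ℕ} {HX : Matrix (Fin mX) (Fin n) (ZMod 2)}
    {HZ : Matrix (Fin mZ) (Fin n) (ZMod 2)} {E : Finset (Fin n)}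
    (hs : ∀ S, IsCSSStoppingSet HX HZ S → s ≤ S.card) (hE : E ∈ FQM HX HZ G) :
    s + G ≤ E.card := by
  rcases hE with ⟨k, f, hf, hG⟩ | ⟨k, f, hf, hG⟩
  · have := hf.guessCount_le fun S hS => hs S (Or.inr hS)
    omega
  · have := hf.guessCount_le fun S hS => hs S (Or.inl hS)
    omega

theorem Pfail_mono {n : ℕ} {F F' : Set (Finset (Fin n))} (h : F ⊆ F') {ε : ℝ} (h0 : 0 ≤ ε)
    (h1 : ε ≤ 1) : Pfail n F ε ≤ Pfail n F' ε := by
  classical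
  have : 0 ≤ 1 - ε := by linarith
  unfold Pfail
  refine Finset.sum_le_sum_of_subset_of_nonneg (fun E hE => ?_) fun E _ _ => by positivity
  simp only [Finset.mem_filter, Finset.mem_univ, true_and] at hE ⊢
  exact h hE

theorem le_Pfail {n : ℕ} {F : Set (Finset (Fin n))} {E : Finset (Fin n)} (hE : E ∈ F) {ε : ℝ}
    (h0 : 0 ≤ ε) (h1 : ε ≤ 1) : ε ^ E.card * (1 - ε) ^ (n - E.card) ≤ Pfail n F ε := by
  classical
  have : 0 ≤ 1 - ε := by linarith
  unfold Pfail
  exact Finset.single_le_sum (f := fun E : Finset (Fin n) => ε ^ E.card * (1 - ε) ^ (n - E.card))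
    (fun E _ => by positivity) (by simpa using hE)

theorem Pfail_union_le_add {n : ℕ} (F F' : Set (Finset (Fin n))) {ε : ℝ} (h0 : 0 ≤ ε)
    (h1 : ε ≤ 1) : Pfail n (F ∪ F') ε ≤ Pfail n F ε + Pfail n F' ε := by
  have h2 : 0 ≤ 1 - ε := by linarith
  simp only [Pfail, Finset.sum_filter, ← Finset.sum_add_distrib]
  refine Finset.sum_le_sum fun E _ => ?_
  have : 0 ≤ ε ^ E.card * (1 - ε) ^ (n - E.card) := by positivity
  by_cases hF : E ∈ F <;> by_cases hF' : E ∈ F' <;> simp [hF, hF', this]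

theorem Pfail_le {n t : ℕ} {F : Set (Finset (Fin n))} (hF : ∀ E ∈ F, t ≤ E.card)
    {ε : ℝ} (h0 : 0 ≤ ε) (h1 : ε ≤ 1) : Pfail n F ε ≤ 2 ^ n * ε ^ t := by
  classical
  have h2 : 0 ≤ 1 - ε := by linarith
  unfold Pfail
  refine (Finset.sum_le_card_nsmul _ _ (ε ^ t) fun E hE => ?_).trans ?_
  · have hE' := hF E (by simpa using hE)
    calc ε ^ E.card * (1 - ε) ^ (n - E.card) ≤ ε ^ E.card * 1 := by
          gcongr
          exact pow_le_one₀ h2 (by linarith)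
      _ ≤ ε ^ t := by
          rw [mul_one]
          exact pow_le_pow_of_le_one h0 h1 hE'
  · rw [nsmul_eq_mul]
    gcongr
    exact_mod_cast (Finset.card_le_univ _).trans_eq (by simp)

/-- Adjoining sets of size larger than that of some member of `F` does not change the leading
behaviour of `Pfail n F` at `0`. -/
theorem tendsto_Pfail_union_div {n : ℕ} {F F' : Set (Finset (Fin n))} {S : Finset (Fin n)}
    (hS : S ∈ F) (hF' : ∀ E ∈ F', S.card + 1 ≤ E.card) :
    Filter.Tendsto (fun ε : ℝ => Pfail n (F ∪ F') ε / Pfail n F ε)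
      (nhdsWithin 0 (Set.Ioi 0)) (nhds 1) := by
  have hlim : Filter.Tendsto (fun ε : ℝ => 1 + 2 ^ n * ε / (1 - ε) ^ (n - S.card))
      (nhdsWithin 0 (Set.Ioi 0)) (nhds 1) := by
    have hc : ContinuousAt (fun ε : ℝ => 1 + 2 ^ n * ε / (1 - ε) ^ (n - S.card)) 0 := by
      refine continuousAt_const.add (ContinuousAt.div (by fun_prop) (by fun_prop) (by simp))
    have := hc.tendsto.mono_left (nhdsWithin_le_nhds (s := Set.Ioi 0))
    simpa using this
  have hmem : ∀ᶠ ε : ℝ in nhdsWithin 0 (Set.Ioi 0), ε ∈ Set.Ioo (0 : ℝ) 1 :=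
    Ioo_mem_nhdsGT one_pos
  have hpos : ∀ ε ∈ Set.Ioo (0 : ℝ) 1, 0 < ε ^ S.card * (1 - ε) ^ (n - S.card) := by
    rintro ε ⟨h0, h1⟩
    have : 0 < 1 - ε := by linarith
    positivity
  refine tendsto_of_tendsto_of_tendsto_of_le_of_le' tendsto_const_nhds hlim ?_ ?_
  · filter_upwards [hmem] with ε hε
    rw [one_le_div ((hpos ε hε).trans_le (le_Pfail hS hε.1.le hε.2.le))]
    exact Pfail_mono Set.subset_union_left hε.1.le hε.2.le
  · filter_upwards [hmem] with ε hε
    have hle := le_Pfail hS hε.1.le hε.2.le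
    have hP := (hpos ε hε).trans_le hle
    have h2 : 0 < 1 - ε := by linarith [hε.2]
    have h0 := hε.1
    rw [div_le_iff₀ hP, add_mul, one_mul]
    refine (Pfail_union_le_add F F' h0.le hε.2.le).trans (add_le_add le_rfl ?_)
    refine (Pfail_le hF' h0.le hε.2.le).trans ?_
    calc 2 ^ n * ε ^ (S.card + 1)
        = 2 ^ n * ε / (1 - ε) ^ (n - S.card) * (ε ^ S.card * (1 - ε) ^ (n - S.card)) := by
          field_simp
          ring
      _ ≤ 2 ^ n * ε / (1 - ε) ^ (n - S.card) * Pfail n F ε := by gcongr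

/-- With `d` the minimum NTLO weight, `s` the minimum stopping set size
and `G ≥ d - s + 1`, the ratio `p_L^QM(G)(ε) / p_L^ML(ε)` tends to `1` as `ε → 0⁺`. -/
theorem maxwell_matches_ml_exponent {mX mZ n : ℕ}
    (HX : Matrix (Fin mX) (Fin n) (ZMod 2)) (HZ : Matrix (Fin mZ) (Fin n) (ZMod 2))
    (hCSS : HX * HZ.transpose = 0) (d s G : ℕ)
    (hd : IsLeast {w : ℕ | ∃ v, IsNTLO HX HZ v ∧ (supp v).card = w} d)
    (hs : IsLeast {w : ℕ | ∃ S : Finset (Fin n), IsCSSStoppingSet HX HZ S ∧ S.card = w} s)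
    (hG : d - s + 1 ≤ G) :
    Filter.Tendsto
      (fun ε : ℝ => Pfail n (FML HX HZ ∪ FQM HX HZ G) ε / Pfail n (FML HX HZ) ε)
      (nhdsWithin 0 (Set.Ioi 0)) (nhds 1) := by
  obtain ⟨⟨v, hv, rfl⟩, -⟩ := hd
  refine tendsto_Pfail_union_div (S := supp v) ⟨v, hv, subset_rfl⟩ fun E hE => ?_
  have := card_ge_of_mem_FQM (fun S hS => hs.2 ⟨S, hS, rfl⟩) hE
  omega
end
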